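/- Suppose the BFGS initialization satisfies σ_0 ≤ ε and ‖Ĥ_0 − I‖_F ≤ δ, where ε, δ > 0 are such that for some r ∈ (0, 1) both [(2δ + 1)·4(1 + 2ε² + ε³)/(1 − ε)² + (3 + 2ε)/(1 − ε)]·ε/(1 − r) ≤ δ and (2δ + 1)ε + 2δ ≤ r. Then for every k ≥ 1, Σ_{t=0}^{k−1} ‖(Ĥ_t − I)ŷ_t‖/‖ŷ_t‖ ≤ 2√2·δ·√k. -/

import Mathlib

noncomputable section

open Matrix Finset

abbrev E (d : ℕ) := EuclideanSpace ℝ (Fin d)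
abbrev Mat (d : ℕ) := Matrix (Fin d) (Fin d) ℝ

/-- Spectral (operator 2-) norm of a real matrix. -/
def spec {d : ℕ} (A : Mat d) : ℝ := ‖Matrix.toEuclideanCLM (𝕜 := ℝ) A‖

/-- Frobenius norm of a real matrix. -/
def frob {d : ℕ} (A : Mat d) : ℝ := Real.sqrt (∑ i, ∑ j, (A i j) ^ 2)

/-- A matrix acting on a Euclidean vector. -/
def mApp {d : ℕ} (A : Mat d) (v : E d) : E d := Matrix.toEuclideanCLM (𝕜 := ℝ) A v

/-- Outer product `u vᵀ`. -/
def outer {d : ℕ} (u v : E d) : Mat d := Matrix.of fun i j => u i * v j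

/-- Euclidean dot product. -/
def dot {d : ℕ} (u v : E d) : ℝ := ∑ i, u i * v i

/-- `σ(x) = (M/μ^{3/2})·‖H_*^{1/2}(x − x_*)‖`. -/
def sig {d : ℕ} (M μ : ℝ) (sqH : Mat d) (xs x : E d) : ℝ :=
  M / μ ^ ((3:ℝ)/2) * ‖mApp sqH (x - xs)‖

/-- The BFGS update of the inverse Hessian approximation. -/
def bfgsUpdate {d : ℕ} (H : Mat d) (s y : E d) : Mat d :=
  (1 - (dot y s)⁻¹ • outer s y) * H * (1 - (dot s y)⁻¹ • outer y s)
    + (dot y s)⁻¹ • outer s s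

section FrobeniusNorm

attribute [local instance] Matrix.frobeniusNormedAddCommGroup Matrix.frobeniusNormedSpace

lemma frob_eq_norm {d : ℕ} (A : Mat d) : frob A = ‖A‖ := by
  rw [Matrix.frobenius_norm_def, frob, Real.sqrt_eq_rpow]
  simp

lemma frob_add_le {d : ℕ} (A B : Mat d) : frob (A + B) ≤ frob A + frob B := by
  simpa only [frob_eq_norm] using norm_add_le A B

lemma frob_mul_le {d : ℕ} (A B : Mat d) : frob (A * B) ≤ frob A * frob B := by
  simpa only [frob_eq_norm] using Matrix.frobenius_norm_mul A B

lemma frob_smul {d : ℕ} (c : ℝ) (A : Mat d) : frob (c • A) = |c| * frob A := by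
  simpa only [frob_eq_norm, Real.norm_eq_abs] using norm_smul c A

end FrobeniusNorm

lemma frob_nonneg {d : ℕ} (A : Mat d) : 0 ≤ frob A := Real.sqrt_nonneg _

lemma frob_sq {d : ℕ} (A : Mat d) : frob A ^ 2 = ∑ i, ∑ j, A i j ^ 2 :=
  Real.sq_sqrt (by positivity)

lemma frob_transpose {d : ℕ} (A : Mat d) : frob Aᵀ = frob A := by
  unfold frob
  rw [Finset.sum_comm]
  rfl

lemma mApp_apply {d : ℕ} (A : Mat d) (v : E d) (i : Fin d) : mApp A v i = ∑ j, A i j * v j := by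
  simp [mApp, Matrix.mulVec, dotProduct]

lemma dot_eq_inner {d : ℕ} (u v : E d) : dot u v = inner ℝ u v := by
  simp [dot, PiLp.inner_apply, mul_comm]

lemma frob_outer {d : ℕ} (u v : E d) : frob (outer u v) = ‖u‖ * ‖v‖ := by
  rw [EuclideanSpace.norm_eq, EuclideanSpace.norm_eq, ← Real.sqrt_mul (by positivity), frob]
  congr 1
  simp [outer, Finset.sum_mul_sum, mul_pow]

lemma norm_mApp_sq {d : ℕ} (A : Mat d) (v : E d) :
    ‖mApp A v‖ ^ 2 = ∑ i, (∑ j, A i j * v j) ^ 2 := by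
  rw [EuclideanSpace.norm_sq_eq]
  simp [mApp_apply]

lemma norm_mApp_le_frob {d : ℕ} (A : Mat d) (v : E d) : ‖mApp A v‖ ≤ frob A * ‖v‖ := by
  apply le_of_sq_le_sq _ (mul_nonneg (frob_nonneg A) (norm_nonneg v))
  rw [norm_mApp_sq, mul_pow, frob_sq, EuclideanSpace.norm_sq_eq, Finset.sum_mul]
  refine Finset.sum_le_sum fun i _ => ?_
  simpa using Finset.sum_mul_sq_le_sq_mul_sq Finset.univ (A i) v

lemma mApp_add {d : ℕ} (A : Mat d) (u v : E d) : mApp A (u + v) = mApp A u + mApp A v :=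
  map_add _ u v

lemma mApp_sub {d : ℕ} (A : Mat d) (u v : E d) : mApp A (u - v) = mApp A u - mApp A v :=
  map_sub _ u v

lemma mApp_smul {d : ℕ} (A : Mat d) (c : ℝ) (v : E d) : mApp A (c • v) = c • mApp A v :=
  map_smul _ c v

lemma mApp_zero {d : ℕ} (A : Mat d) : mApp A 0 = 0 :=
  map_zero _

lemma mApp_mul {d : ℕ} (A B : Mat d) (v : E d) : mApp (A * B) v = mApp A (mApp B v) := by
  simp [mApp, map_mul]

lemma mApp_one {d : ℕ} (v : E d) : mApp 1 v = v := by
  simp [mApp]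

lemma sub_mApp {d : ℕ} (A B : Mat d) (v : E d) : mApp (A - B) v = mApp A v - mApp B v := by
  simp [mApp, map_sub]

lemma norm_mApp_le_spec {d : ℕ} (A : Mat d) (v : E d) : ‖mApp A v‖ ≤ spec A * ‖v‖ :=
  (Matrix.toEuclideanCLM (𝕜 := ℝ) A).le_opNorm v

lemma dot_mApp {d : ℕ} (A : Mat d) (u v : E d) : dot u (mApp A v) = dot (mApp Aᵀ u) v := by
  simp only [dot, mApp_apply, Finset.mul_sum, Finset.sum_mul, Matrix.transpose_apply]
  rw [Finset.sum_comm]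
  exact Finset.sum_congr rfl fun i _ => Finset.sum_congr rfl fun j _ => by ring

lemma outer_mul_outer {d : ℕ} (u v w z : E d) : outer u v * outer w z = dot v w • outer u z := by
  ext i j
  simp only [Matrix.mul_apply, outer, Matrix.of_apply, Matrix.smul_apply, smul_eq_mul, dot,
    Finset.sum_mul]
  exact Finset.sum_congr rfl fun k _ => by ring

lemma mul_outer {d : ℕ} (A : Mat d) (u v : E d) : A * outer u v = outer (mApp A u) v := by
  ext i j
  simp only [Matrix.mul_apply, outer, Matrix.of_apply, mApp_apply, Finset.sum_mul]
  exact Finset.sum_congr rfl fun k _ => by ring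

lemma outer_mul {d : ℕ} (A : Mat d) (u v : E d) : outer u v * A = outer u (mApp Aᵀ v) := by
  ext i j
  simp only [Matrix.mul_apply, outer, Matrix.of_apply, mApp_apply, Finset.mul_sum,
    Matrix.transpose_apply]
  exact Finset.sum_congr rfl fun k _ => by ring

lemma outer_transpose {d : ℕ} (u v : E d) : (outer u v)ᵀ = outer v u := by
  ext i j
  simp [outer, mul_comm]

lemma outer_sub_left {d : ℕ} (u v w : E d) : outer (u - v) w = outer u w - outer v w := by
  ext i j
  simp [outer, sub_mul]

lemma outer_sub_right {d : ℕ} (u v w : E d) : outer u (v - w) = outer u v - outer u w := by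
  ext i j
  simp [outer, mul_sub]

lemma outer_smul_left {d : ℕ} (c : ℝ) (u v : E d) : outer (c • u) v = c • outer u v := by
  ext i j
  simp [outer, mul_assoc]

lemma outer_smul_right {d : ℕ} (c : ℝ) (u v : E d) : outer u (c • v) = c • outer u v := by
  ext i j
  simp only [outer, Matrix.of_apply, PiLp.smul_apply, Matrix.smul_apply, smul_eq_mul]
  ring

/-- Right multiplication by the orthogonal projection onto `uᗮ` removes exactly the energy of `u`. -/
lemma frob_mul_proj_sq {d : ℕ} (D : Mat d) (u : E d) (hu : ‖u‖ = 1) :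
    frob (D * (1 - outer u u)) ^ 2 = frob D ^ 2 - ‖mApp D u‖ ^ 2 := by
  have hu2 : ∑ j, u j ^ 2 = 1 := by
    have h := EuclideanSpace.norm_sq_eq u
    rw [hu] at h
    simpa using h.symm
  rw [mul_sub, mul_one, mul_outer, frob_sq, frob_sq, norm_mApp_sq, ← Finset.sum_sub_distrib]
  refine Finset.sum_congr rfl fun i _ => ?_
  have h : ∀ j, (D - outer (mApp D u) u) i j ^ 2
      = D i j ^ 2 - 2 * mApp D u i * (D i j * u j) + mApp D u i ^ 2 * u j ^ 2 := fun j => by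
    simp only [Matrix.sub_apply, outer, Matrix.of_apply]
    ring
  simp only [h, Finset.sum_add_distrib, Finset.sum_sub_distrib, ← Finset.mul_sum, hu2]
  rw [← mApp_apply]
  ring

lemma frob_proj_mul_le {d : ℕ} (D : Mat d) (u : E d) (hu : ‖u‖ = 1) :
    frob ((1 - outer u u) * D) ≤ frob D := by
  rw [← frob_transpose, ← frob_transpose D, Matrix.transpose_mul, Matrix.transpose_sub,
    outer_transpose, Matrix.transpose_one]
  apply le_of_sq_le_sq _ (frob_nonneg _)
  rw [frob_mul_proj_sq _ u hu]
  linarith [sq_nonneg ‖mApp Dᵀ u‖]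

lemma frob_mul_proj_le {d : ℕ} (D : Mat d) (u : E d) (hu : ‖u‖ = 1) :
    frob (D * (1 - outer u u)) ≤ frob D := by
  apply le_of_sq_le_sq _ (frob_nonneg _)
  rw [frob_mul_proj_sq _ u hu]
  linarith [sq_nonneg ‖mApp D u‖]

lemma frob_proj_mul_proj_le {d : ℕ} (D : Mat d) (u : E d) (hu : ‖u‖ = 1) {c : ℝ} (hc : 0 < c)
    (hD : frob D ≤ c) :
    frob ((1 - outer u u) * D * (1 - outer u u)) ≤ frob D - ‖mApp D u‖ ^ 2 / (2 * c) := by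
  have h1 : frob ((1 - outer u u) * D * (1 - outer u u)) ^ 2 ≤ frob D ^ 2 - ‖mApp D u‖ ^ 2 := by
    rw [← frob_mul_proj_sq D u hu, mul_assoc]
    exact pow_le_pow_left₀ (frob_nonneg _) (frob_proj_mul_le _ u hu) 2
  have h2 : ‖mApp D u‖ ≤ frob D := by simpa [hu] using norm_mApp_le_frob D u
  set p := frob ((1 - outer u u) * D * (1 - outer u u))
  have hp : 0 ≤ p := frob_nonneg _
  set n := ‖mApp D u‖
  have hn : 0 ≤ n := norm_nonneg _
  set a := frob D
  have h3 : n ^ 2 / (2 * c) ≤ a - p := by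
    rw [div_le_iff₀ (by positivity)]
    have h4 : p ≤ a := by nlinarith
    nlinarith [mul_nonneg (sub_nonneg.2 h4) (sub_nonneg.2 hD), sq_nonneg (a - p)]
  linarith

/-- The BFGS residual in terms of the direction `u` of `y` and the relative deviation `e ⟂ u`
of `s` from that direction. -/
lemma bfgsUpdate_sub_one {d : ℕ} (H : Mat d) (u e : E d) (a b : ℝ) (ha : a ≠ 0) (hb : b ≠ 0)
    (hu : dot u u = 1) (hue : dot u e = 0) :
    bfgsUpdate H (a • (u - e)) (b • u) - 1
      = (1 - outer u u) * (H - 1) * (1 - outer u u)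
        + outer e u * ((H - 1) * (1 - outer u u))
        + (1 - outer u u) * (H - 1) * outer u e
        + outer e u * (H - 1) * outer u e + outer e e + (a / b - 1) • outer u u
        + (-(a / b)) • outer u e + (-(a / b)) • outer e u + (a / b) • outer e e := by
  have h1 : dot (b • u) (a • (u - e)) = a * b := by
    rw [dot_eq_inner] at hu hue ⊢
    rw [real_inner_smul_left, real_inner_smul_right, inner_sub_right, hu, hue]
    ring
  have h2 : dot (a • (u - e)) (b • u) = a * b := by
    rw [dot_eq_inner, real_inner_comm, ← dot_eq_inner, h1]
  have h3 : (a * b)⁻¹ • outer (a • (u - e)) (b • u) = outer u u - outer e u := by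
    rw [outer_smul_left, outer_smul_right, smul_smul, smul_smul, outer_sub_left,
      show (a * b)⁻¹ * a * b = 1 by field_simp, one_smul]
  have h4 : (a * b)⁻¹ • outer (b • u) (a • (u - e)) = outer u u - outer u e := by
    rw [outer_smul_left, outer_smul_right, smul_smul, smul_smul, outer_sub_right,
      show (a * b)⁻¹ * b * a = 1 by field_simp, one_smul]
  have h5 : (a * b)⁻¹ • outer (a • (u - e)) (a • (u - e))
      = (a / b) • (outer u u - outer e u - (outer u e - outer e e)) := by
    rw [outer_smul_left, outer_smul_right, smul_smul, smul_smul, outer_sub_right, outer_sub_left,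
      outer_sub_left, show (a * b)⁻¹ * a * a = a / b by field_simp]
  have huu : outer u u * outer u u = outer u u := by rw [outer_mul_outer, hu, one_smul]
  have hue' : outer u u * outer u e = outer u e := by rw [outer_mul_outer, hu, one_smul]
  have heu : outer e u * outer u u = outer e u := by rw [outer_mul_outer, hu, one_smul]
  have hee : outer e u * outer u e = outer e e := by rw [outer_mul_outer, hu, one_smul]
  have h6 : bfgsUpdate H (a • (u - e)) (b • u)
      = (1 - outer u u + outer e u) * H * (1 - outer u u + outer u e)
        + (a / b) • (outer u u - outer e u - (outer u e - outer e e)) := by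
    rw [bfgsUpdate, h1, h2, h3, h4, h5, sub_add, sub_add]
  have h7 : (1 - outer u u + outer e u) * (1 - outer u u + outer u e)
      = 1 - outer u u + outer e e := by
    simp only [mul_add, add_mul, mul_sub, sub_mul, one_mul, mul_one, huu, hue', heu, hee]
    abel
  have h8 : (1 - outer u u + outer e u) * H * (1 - outer u u + outer u e)
      = (1 - outer u u + outer e u) * (H - 1) * (1 - outer u u + outer u e)
        + (1 - outer u u + outer e e) := by
    rw [← h7]
    noncomm_ring
  rw [h6, h8]
  generalize H - 1 = D
  simp only [sub_smul, neg_smul, smul_sub, one_smul]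
  noncomm_ring

lemma frob_bfgsUpdate_sub_one_le {d : ℕ} (H : Mat d) (u e : E d) (a b : ℝ) (ha : 0 < a) (hb : 0 < b)
    (hu : ‖u‖ = 1) (hue : dot u e = 0) {c : ℝ} (hc : 0 < c) (hD : frob (H - 1) ≤ c) :
    frob (bfgsUpdate H (a • (u - e)) (b • u) - 1)
      ≤ frob (H - 1) - ‖mApp (H - 1) u‖ ^ 2 / (2 * c) + 2 * ‖e‖ * c + (1 + c) * ‖e‖ ^ 2
        + |a / b - 1| + 2 * (a / b) * ‖e‖ + (a / b) * ‖e‖ ^ 2 := by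
  have huu : dot u u = 1 := by rw [dot_eq_inner, real_inner_self_eq_norm_sq, hu]; norm_num
  rw [bfgsUpdate_sub_one H u e a b ha.ne' hb.ne' huu hue]
  have hab : |a / b| = a / b := abs_of_pos (by positivity)
  have t1 := frob_proj_mul_proj_le (H - 1) u hu hc hD
  have t2 : frob (outer e u * ((H - 1) * (1 - outer u u))) ≤ ‖e‖ * c := by
    refine (frob_mul_le _ _).trans ?_
    rw [frob_outer, hu, mul_one]
    exact mul_le_mul_of_nonneg_left ((frob_mul_proj_le _ u hu).trans hD) (norm_nonneg _)
  have t3 : frob ((1 - outer u u) * (H - 1) * outer u e) ≤ c * ‖e‖ := by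
    refine (frob_mul_le _ _).trans ?_
    rw [frob_outer, hu, one_mul]
    exact mul_le_mul_of_nonneg_right ((frob_proj_mul_le _ u hu).trans hD) (norm_nonneg _)
  have t4 : frob (outer e u * (H - 1) * outer u e) ≤ ‖e‖ * c * ‖e‖ := by
    refine (frob_mul_le _ _).trans ?_
    rw [frob_outer, hu, one_mul]
    refine mul_le_mul_of_nonneg_right ((frob_mul_le _ _).trans ?_) (norm_nonneg _)
    rw [frob_outer, hu, mul_one]
    exact mul_le_mul_of_nonneg_left hD (norm_nonneg _)
  have t5 : frob (outer e e) = ‖e‖ * ‖e‖ := frob_outer e e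
  have t6 : frob ((a / b - 1) • outer u u) = |a / b - 1| := by
    rw [frob_smul, frob_outer, hu]; ring
  have t7 : frob ((-(a / b)) • outer u e) = a / b * ‖e‖ := by
    rw [frob_smul, frob_outer, hu, abs_neg, hab]; ring
  have t8 : frob ((-(a / b)) • outer e u) = a / b * ‖e‖ := by
    rw [frob_smul, frob_outer, hu, abs_neg, hab]; ring
  have t9 : frob ((a / b) • outer e e) = a / b * (‖e‖ * ‖e‖) := by
    rw [frob_smul, frob_outer, hab]
  set M1 := (1 - outer u u) * (H - 1) * (1 - outer u u)
  set M2 := outer e u * ((H - 1) * (1 - outer u u))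
  set M3 := (1 - outer u u) * (H - 1) * outer u e
  set M4 := outer e u * (H - 1) * outer u e
  set M5 := outer e e
  set M6 := (a / b - 1) • outer u u
  set M7 := (-(a / b)) • outer u e
  set M8 := (-(a / b)) • outer e u
  have s1 := frob_add_le M1 M2
  have s2 := frob_add_le (M1 + M2) M3
  have s3 := frob_add_le (M1 + M2 + M3) M4
  have s4 := frob_add_le (M1 + M2 + M3 + M4) M5
  have s5 := frob_add_le (M1 + M2 + M3 + M4 + M5) M6
  have s6 := frob_add_le (M1 + M2 + M3 + M4 + M5 + M6) M7
  have s7 := frob_add_le (M1 + M2 + M3 + M4 + M5 + M6 + M7) M8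
  have s8 := frob_add_le (M1 + M2 + M3 + M4 + M5 + M6 + M7 + M8) ((a / b) • M5)
  nlinarith

/-- The drift constant of the Frobenius residual. -/
def driftConst (δ ε : ℝ) : ℝ :=
  (2 * δ + 1) * (4 * (1 + 2 * ε ^ 2 + ε ^ 3) / (1 - ε) ^ 2) + (3 + 2 * ε) / (1 - ε)

lemma driftConst_bound {δ ε τ t c : ℝ} (hδ : 0 < δ) (hτ : 0 ≤ τ) (hτε : τ ≤ ε) (hε1 : ε < 1)
    (ht : 0 ≤ t) (ht2 : t ^ 2 * (1 - τ ^ 2) ≤ τ ^ 2) (hc : |c - 1| ≤ τ / (1 - τ)) :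
    2 * t * (2 * δ) + (1 + 2 * δ) * t ^ 2 + |c - 1| + 2 * c * t + c * t ^ 2
      ≤ driftConst δ ε * τ := by
  have hε : 0 ≤ ε := hτ.trans hτε
  set m := 1 / (1 - ε) with hm
  have hm0 : 0 < 1 - ε := by linarith
  have hmul : m * (1 - ε) = 1 := by rw [hm]; field_simp
  have hm1 : 1 ≤ m := by rw [hm, le_div_iff₀ hm0]; linarith
  have hττ : τ / (1 - τ) ≤ τ * m := by
    rw [hm, div_eq_mul_one_div]
    gcongr
  have hc1 : |c - 1| ≤ τ * m := hc.trans hττ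
  have hcm : c ≤ m := by
    have h1 := (abs_le.1 hc1).2
    nlinarith
  have ht2' : t ^ 2 ≤ ε * τ * m := by
    have h1 : t ^ 2 * (1 - ε) ≤ ε * τ := by
      have h2 : 1 - ε ≤ 1 - τ ^ 2 := by nlinarith
      nlinarith [mul_le_mul_of_nonneg_left h2 (sq_nonneg t)]
    calc t ^ 2 = t ^ 2 * (1 - ε) * m := by rw [mul_assoc, mul_comm (1 - ε), hmul, mul_one]
      _ ≤ _ := by gcongr
  have ht1 : t ≤ τ * m := by
    refine le_of_sq_le_sq ?_ (by positivity)
    have h1 : t ^ 2 * (1 - ε) ^ 2 ≤ τ ^ 2 := by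
      have : (1 - ε) ^ 2 ≤ 1 - τ ^ 2 := by nlinarith
      nlinarith [sq_nonneg t]
    calc t ^ 2 = t ^ 2 * (1 - ε) ^ 2 * m ^ 2 := by
          rw [mul_assoc, ← mul_pow, mul_comm (1 - ε), hmul]; ring
      _ ≤ τ ^ 2 * m ^ 2 := by gcongr
      _ = _ := by ring
  have b1 : 2 * t * (2 * δ) ≤ 2 * (τ * m) * (2 * δ) := by gcongr
  have b2 : (1 + 2 * δ) * t ^ 2 ≤ (1 + 2 * δ) * (ε * τ * m) := by gcongr
  have b3 : 2 * c * t ≤ 2 * m * (τ * m) := by gcongr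
  have b4 : c * t ^ 2 ≤ m * (ε * τ * m) := by gcongr
  have hW : driftConst δ ε = (2 * δ + 1) * (4 * (1 + 2 * ε ^ 2 + ε ^ 3)) * m ^ 2
      + (3 + 2 * ε) * m := by
    simp only [driftConst, hm, div_eq_mul_inv, ← inv_pow]
    ring
  have key : 4 * δ * m + (1 + 2 * δ) * ε * m + m + 2 * m ^ 2 + ε * m ^ 2 ≤ driftConst δ ε := by
    rw [hW]
    have hmm : m ≤ m ^ 2 := by nlinarith
    have h1 : 4 * δ * m ≤ 4 * δ * m ^ 2 := by gcongr
    have h2 : (1 + 2 * δ) * ε * m ≤ (1 + 2 * δ) * 1 * m ^ 2 := by gcongr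
    have h3 : ε * m ^ 2 ≤ 1 * m ^ 2 := by gcongr
    have h4 : (2 * δ + 1) * (4 * 1) * m ^ 2
        ≤ (2 * δ + 1) * (4 * (1 + 2 * ε ^ 2 + ε ^ 3)) * m ^ 2 := by
      gcongr
      linarith [pow_nonneg hε 2, pow_nonneg hε 3]
    have h5 : 0 ≤ ε * m := by positivity
    have h6 : 0 ≤ δ * m ^ 2 := by positivity
    nlinarith
  nlinarith [mul_le_mul_of_nonneg_right key hτ]

lemma frob_bfgsUpdate_sub_one_le_of_close {d : ℕ} (H : Mat d) (s y : E d) {δ ε τ : ℝ} (hδ : 0 < δ)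
    (hτ : 0 ≤ τ) (hτε : τ ≤ ε) (hε1 : ε < 1) (hs : s ≠ 0) (hys : ‖y - s‖ ≤ τ * ‖s‖)
    (hD : frob (H - 1) ≤ 2 * δ) :
    frob (bfgsUpdate H s y - 1)
      ≤ frob (H - 1) - (‖mApp (H - 1) y‖ / ‖y‖) ^ 2 / (4 * δ) + driftConst δ ε * τ := by
  have hs0 : 0 < ‖s‖ := norm_pos_iff.2 hs
  have hτ1 : τ < 1 := by linarith
  have hyl : (1 - τ) * ‖s‖ ≤ ‖y‖ := by
    have := norm_sub_norm_le s y
    rw [norm_sub_rev] at this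
    linarith
  have hb : 0 < ‖y‖ := lt_of_lt_of_le (mul_pos (by linarith) hs0) hyl
  set b := ‖y‖ with hbdef
  set u : E d := b⁻¹ • y with hudef
  have hyu : y = b • u := by rw [hudef, smul_smul, mul_inv_cancel₀ hb.ne', one_smul]
  have hu : ‖u‖ = 1 := by
    rw [hudef, norm_smul, norm_inv, Real.norm_eq_abs, abs_of_pos hb, ← hbdef]
    exact inv_mul_cancel₀ hb.ne'
  set a : ℝ := inner ℝ u s with hadef
  have hexp : ‖y - s‖ ^ 2 = b ^ 2 - 2 * (b * a) + ‖s‖ ^ 2 := by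
    rw [norm_sub_sq_real, ← hbdef, hyu, real_inner_smul_left]
  have hsq : ‖y - s‖ ^ 2 ≤ τ ^ 2 * ‖s‖ ^ 2 := by
    rw [← mul_pow]
    exact pow_le_pow_left₀ (norm_nonneg _) hys 2
  have ha : 0 < a := by
    by_contra! h
    have h1 : b * a ≤ 0 := mul_nonpos_of_nonneg_of_nonpos hb.le h
    have h2 : τ ^ 2 * ‖s‖ ^ 2 ≤ 1 * ‖s‖ ^ 2 := by
      gcongr
      nlinarith
    nlinarith
  set e : E d := u - a⁻¹ • s with hedef
  have hse : s = a • (u - e) := by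
    rw [hedef, sub_sub_cancel, smul_smul, mul_inv_cancel₀ ha.ne', one_smul]
  have huu : inner ℝ u u = (1 : ℝ) := by rw [real_inner_self_eq_norm_sq, hu]; norm_num
  have hue : inner ℝ u e = (0 : ℝ) := by
    rw [hedef, inner_sub_right, huu, real_inner_smul_right, ← hadef, inv_mul_cancel₀ ha.ne',
      sub_self]
  have hsn : ‖s‖ ^ 2 = a ^ 2 * (1 + ‖e‖ ^ 2) := by
    rw [hse, norm_smul, mul_pow, norm_sub_sq_real, hu, hue, Real.norm_eq_abs, sq_abs]
    ring
  have ht2 : ‖e‖ ^ 2 * (1 - τ ^ 2) ≤ τ ^ 2 := by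
    have h1 : a ^ 2 * ‖e‖ ^ 2 ≤ a ^ 2 * (τ ^ 2 * (1 + ‖e‖ ^ 2)) := by
      nlinarith [sq_nonneg (b - a)]
    have := le_of_mul_le_mul_left h1 (by positivity)
    linarith
  have hc : |a / b - 1| ≤ τ / (1 - τ) := by
    have h1 : a - b = inner ℝ u (s - y) := by
      rw [inner_sub_right, ← hadef, hyu, real_inner_smul_right, huu, mul_one]
    have h2 : |a - b| ≤ τ * ‖s‖ := by
      rw [h1]
      refine (abs_real_inner_le_norm _ _).trans ?_
      rw [hu, one_mul, norm_sub_rev]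
      exact hys
    rw [div_sub_one hb.ne', abs_div, abs_of_pos hb, div_le_div_iff₀ hb (by linarith)]
    nlinarith [abs_nonneg (a - b)]
  have hmain := frob_bfgsUpdate_sub_one_le H u e a b ha hb hu
    (by rw [dot_eq_inner, hue]) (c := 2 * δ) (by linarith) hD
  rw [← hse, ← hyu] at hmain
  have hdrift := driftConst_bound hδ hτ hτε hε1 (norm_nonneg e) ht2 hc
  have hq : ‖mApp (H - 1) y‖ / b = ‖mApp (H - 1) u‖ := by
    rw [hudef, mApp_smul, norm_smul, norm_inv, Real.norm_eq_abs, abs_of_pos hb]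
    ring
  rw [hq]
  rw [show 2 * (2 * δ) = 4 * δ by ring] at hmain
  linarith

/-- The cumulative bound for BFGS in coordinates in which the Hessian at the solution is the
identity. -/
lemma bfgs_cumulative_residual_bound_normalized {d : ℕ} (G : E d → E d) (ws : E d) (K : ℝ)
    (hK : 0 < K) (hG0 : G ws = 0)
    (hG : ∀ R w w', ‖w - ws‖ ≤ R → ‖w' - ws‖ ≤ R →
      ‖G w - G w' - (w - w')‖ ≤ K * R * ‖w - w'‖)
    (w : ℕ → E d) (H : ℕ → Mat d)
    (hw : ∀ k, w (k + 1) = w k - mApp (H k) (G (w k)))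
    (hne : ∀ k, w (k + 1) - w k ≠ 0)
    (hH : ∀ k, H (k + 1) = bfgsUpdate (H k) (w (k + 1) - w k) (G (w (k + 1)) - G (w k)))
    (ε δ r : ℝ) (hδ : 0 < δ) (hr0 : 0 < r) (hr1 : r < 1)
    (hc1 : driftConst δ ε * (ε / (1 - r)) ≤ δ)
    (hc2 : (2 * δ + 1) * ε + 2 * δ ≤ r)
    (hσ0 : K * ‖w 0 - ws‖ ≤ ε) (hH0 : frob (H 0 - 1) ≤ δ) (k : ℕ) :
    ∑ t ∈ Finset.range k,
        ‖mApp (H t - 1) (G (w (t + 1)) - G (w t))‖ / ‖G (w (t + 1)) - G (w t)‖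
      ≤ 2 * Real.sqrt 2 * δ * Real.sqrt (k : ℝ) := by
  have hε : 0 ≤ ε := le_trans (by positivity) hσ0
  have hε1 : ε < 1 := by nlinarith
  have hW : 0 ≤ driftConst δ ε := by
    have : 0 < 1 - ε := by linarith
    unfold driftConst
    positivity
  have hr : 0 < 1 - r := by linarith
  set q : ℕ → ℝ := fun t =>
    ‖mApp (H t - 1) (G (w (t + 1)) - G (w t))‖ / ‖G (w (t + 1)) - G (w t)‖ with hq
  have inv : ∀ k, K * ‖w k - ws‖ ≤ ε ∧
      frob (H k - 1) + (∑ t ∈ Finset.range k, q t ^ 2) / (4 * δ)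
        + driftConst δ ε * (K * ‖w k - ws‖) / (1 - r) ≤ 2 * δ := by
    intro k
    induction k with
    | zero =>
      refine ⟨hσ0, ?_⟩
      have : driftConst δ ε * (K * ‖w 0 - ws‖) / (1 - r) ≤ driftConst δ ε * (ε / (1 - r)) := by
        rw [mul_div_assoc]
        gcongr
      simp only [Finset.range_zero, Finset.sum_empty, zero_div]
      linarith
    | succ k ih =>
      obtain ⟨ih1, ih2⟩ := ih
      set σ := K * ‖w k - ws‖ with hσ
      have hσn : 0 ≤ σ := by positivity
      have hD : frob (H k - 1) ≤ 2 * δ := by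
        have h1 : 0 ≤ (∑ t ∈ Finset.range k, q t ^ 2) / (4 * δ) := by positivity
        have h2 : 0 ≤ driftConst δ ε * σ / (1 - r) := by positivity
        linarith
      have hgrad : ‖G (w k) - (w k - ws)‖ ≤ ε * ‖w k - ws‖ := by
        have h1 := hG ‖w k - ws‖ (w k) ws le_rfl (by simp)
        rw [hG0, sub_zero] at h1
        exact h1.trans (by gcongr)
      have hcontr : ‖w (k + 1) - ws‖ ≤ r * ‖w k - ws‖ := by
        have h1 : w (k + 1) - ws = -(mApp (H k - 1) (w k - ws))
            - (mApp (H k - 1) (G (w k) - (w k - ws)) + (G (w k) - (w k - ws))) := by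
          have h2 : mApp (H k - 1) (w k - ws) + mApp (H k - 1) (G (w k) - (w k - ws))
              = mApp (H k) (G (w k)) - G (w k) := by
            rw [← mApp_add, add_sub_cancel, sub_mApp, mApp_one]
          rw [hw, eq_sub_of_add_eq' h2]
          abel
        rw [h1]
        have h2 := (norm_mApp_le_frob (H k - 1) (w k - ws)).trans
          (mul_le_mul_of_nonneg_right hD (norm_nonneg _))
        have h3 := (norm_mApp_le_frob (H k - 1) (G (w k) - (w k - ws))).trans
          (mul_le_mul hD hgrad (norm_nonneg _) (by positivity))
        have h4 := norm_sub_le (-(mApp (H k - 1) (w k - ws)))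
          (mApp (H k - 1) (G (w k) - (w k - ws)) + (G (w k) - (w k - ws)))
        have h5 := norm_add_le (mApp (H k - 1) (G (w k) - (w k - ws))) (G (w k) - (w k - ws))
        rw [norm_neg] at h4
        have h6 := mul_le_mul_of_nonneg_right hc2 (norm_nonneg (w k - ws))
        linarith
      have hσ' : K * ‖w (k + 1) - ws‖ ≤ r * σ := by
        rw [hσ, mul_left_comm]
        gcongr
      have hle : ‖w (k + 1) - ws‖ ≤ ‖w k - ws‖ :=
        hcontr.trans (mul_le_of_le_one_left (norm_nonneg _) hr1.le)
      refine ⟨hσ'.trans ((mul_le_of_le_one_left hσn hr1.le).trans ih1), ?_⟩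
      have hstep := frob_bfgsUpdate_sub_one_le_of_close (H k) (w (k + 1) - w k)
        (G (w (k + 1)) - G (w k)) hδ hσn ih1 hε1 (hne k) (hG _ _ _ hle le_rfl) hD
      rw [← hH] at hstep
      rw [Finset.sum_range_succ, add_div]
      have h7 : driftConst δ ε * (K * ‖w (k + 1) - ws‖) / (1 - r)
          ≤ driftConst δ ε * σ / (1 - r) - driftConst δ ε * σ := by
        have h8 : driftConst δ ε * σ / (1 - r) - driftConst δ ε * σ
            = driftConst δ ε * (r * σ) / (1 - r) := by
          field_simp
          ring
        rw [h8]
        gcongr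
      have h9 : q k ^ 2 / (4 * δ) = (‖mApp (H k - 1) (G (w (k + 1)) - G (w k))‖
        / ‖G (w (k + 1)) - G (w k)‖) ^ 2 / (4 * δ) := rfl
      linarith
  have hsum : ∑ t ∈ Finset.range k, q t ^ 2 ≤ 8 * δ ^ 2 := by
    have h1 := (inv k).2
    have h2 : 0 ≤ driftConst δ ε * (K * ‖w k - ws‖) / (1 - r) := by positivity
    have h3 : (∑ t ∈ Finset.range k, q t ^ 2) / (4 * δ) ≤ 2 * δ := by
      linarith [frob_nonneg (H k - 1)]
    rw [div_le_iff₀ (by positivity)] at h3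
    linarith
  refine le_of_sq_le_sq ?_ (by positivity)
  calc (∑ t ∈ Finset.range k, q t) ^ 2 ≤ k * ∑ t ∈ Finset.range k, q t ^ 2 := by
        simpa using sq_sum_le_card_mul_sum_sq (s := Finset.range k) (f := q)
    _ ≤ k * (8 * δ ^ 2) := by gcongr
    _ = (2 * Real.sqrt 2 * δ * Real.sqrt (k : ℝ)) ^ 2 := by
        rw [mul_pow, mul_pow, mul_pow, Real.sq_sqrt (by positivity), Real.sq_sqrt (by positivity)]
        ring

theorem bfgs_cumulative_residual_bound
    {d : ℕ}
    (f : E d → ℝ) (g : E d → E d) (Hess : E d → Mat d) (xs : E d)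
    (μ L M : ℝ) (hμ : 0 < μ) (hμL : μ ≤ L) (hM : 0 < M)
    -- `g` is the gradient of `f`, and `Hess` its Hessian (so `f` is twice differentiable)
    (hg : ∀ x, HasGradientAt f (g x) x)
    (hHd : ∀ x, HasFDerivAt g (Matrix.toEuclideanCLM (𝕜 := ℝ) (Hess x)) x)
    -- `xs` is the unique minimizer of `f`
    (hmin : ∀ x, f xs ≤ f x)
    (huniq : ∀ x, (∀ y, f x ≤ f y) → x = xs)
    -- Assumption 1: strong convexity and gradient Lipschitz continuity
    (hgl : ∀ x y, μ * ‖x - y‖ ≤ ‖g x - g y‖)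
    (hgu : ∀ x y, ‖g x - g y‖ ≤ L * ‖x - y‖)
    (hHl : ∀ x v, μ * ‖v‖ ^ 2 ≤ dot v (mApp (Hess x) v))
    (hHu : ∀ x v, dot v (mApp (Hess x) v) ≤ L * ‖v‖ ^ 2)
    -- Assumption 2: Hessian Lipschitz continuity toward the optimum
    (hLip : ∀ x, spec (Hess x - Hess xs) ≤ M * ‖x - xs‖)
    -- `sqH` is the positive definite square root `H_*^{1/2}` of `H_* = ∇²f(x_*)`
    (sqH : Mat d) (hsqH : sqH.PosDef) (hsqH2 : sqH * sqH = Hess xs)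
    -- the BFGS method
    (x : ℕ → E d) (H : ℕ → Mat d)
    (hH0pd : (H 0).PosDef)
    (hxup : ∀ k, x (k+1) = x k - mApp (H k) (g (x k)))
    (hsne : ∀ k, x (k+1) - x k ≠ 0)
    (hHup : ∀ k, H (k+1) = bfgsUpdate (H k) (x (k+1) - x k) (g (x (k+1)) - g (x k)))
    (ε δ r : ℝ) (hε : 0 < ε) (hδ : 0 < δ) (hr0 : 0 < r) (hr1 : r < 1)
    (hc1 : ((2*δ + 1) * (4 * (1 + 2*ε^2 + ε^3) / (1 - ε)^2) + (3 + 2*ε) / (1 - ε)) * (ε / (1 - r)) ≤ δ)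
    (hc2 : (2*δ + 1) * ε + 2*δ ≤ r)
    (hσ0 : sig M μ sqH xs (x 0) ≤ ε)
    (hH0 : frob (sqH * H 0 * sqH - 1) ≤ δ) :
    ∀ k : ℕ, 1 ≤ k →
      ∑ t ∈ Finset.range k,
          ‖mApp (sqH * H t * sqH - 1) (mApp sqH⁻¹ (g (x (t+1)) - g (x t)))‖
            / ‖mApp sqH⁻¹ (g (x (t+1)) - g (x t))‖ ≤
        2 * Real.sqrt 2 * δ * Real.sqrt (k:ℝ) := by
  intro k _
  set B := sqH⁻¹ with hB
  have hdet : IsUnit sqH.det := sqH.isUnit_iff_isUnit_det.1 hsqH.isUnit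
  have hSB : sqH * B = 1 := sqH.mul_nonsing_inv hdet
  have hBS : B * sqH = 1 := sqH.nonsing_inv_mul hdet
  have hSt : sqHᵀ = sqH := by simpa using hsqH.isHermitian.eq
  have hBt : Bᵀ = B := by rw [hB, Matrix.transpose_nonsing_inv, hSt]
  have hSBv : ∀ v, mApp sqH (mApp B v) = v := fun v => by rw [← mApp_mul, hSB, mApp_one]
  have hBSv : ∀ v, mApp B (mApp sqH v) = v := fun v => by rw [← mApp_mul, hBS, mApp_one]
  have hsμ : 0 < Real.sqrt μ := Real.sqrt_pos.2 hμ
  have hBn : ∀ v, ‖mApp B v‖ ≤ (Real.sqrt μ)⁻¹ * ‖v‖ := by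
    intro v
    refine le_of_sq_le_sq ?_ (by positivity)
    have h1 := hHl xs (mApp B v)
    rw [← hsqH2, mApp_mul, hSBv, dot_mApp, hSt, hSBv, dot_eq_inner,
      real_inner_self_eq_norm_sq] at h1
    rw [mul_pow, inv_pow, Real.sq_sqrt hμ.le, inv_mul_eq_div, le_div_iff₀ hμ]
    linarith
  have hpow : μ ^ ((3 : ℝ) / 2) = Real.sqrt μ ^ 3 := by
    rw [Real.sqrt_eq_rpow, ← Real.rpow_natCast, ← Real.rpow_mul hμ.le]
    norm_num
  have hK : 0 < M / μ ^ ((3 : ℝ) / 2) := by positivity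
  have hgxs : g xs = 0 := by
    have h1 : IsLocalMin f xs := Filter.Eventually.of_forall hmin
    simpa using h1.hasFDerivAt_eq_zero (hg xs).hasFDerivAt
  set G : E d → E d := fun w => mApp B (g (mApp B w)) with hG
  have hGS : ∀ v, G (mApp sqH v) = mApp B (g v) := fun v => by rw [hG]; simp only [hBSv]
  have hGdiff : ∀ R w w', ‖w - mApp sqH xs‖ ≤ R → ‖w' - mApp sqH xs‖ ≤ R →
      ‖G w - G w' - (w - w')‖ ≤ M / μ ^ ((3 : ℝ) / 2) * R * ‖w - w'‖ := by
    intro R w w' hwR hwR'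
    have hder : ∀ z, HasFDerivAt (fun w => G w - w)
        (Matrix.toEuclideanCLM (𝕜 := ℝ) (B * Hess (mApp B z) * B - 1)) z := by
      intro z
      have hB' : ∀ z, HasFDerivAt (mApp B) (Matrix.toEuclideanCLM (𝕜 := ℝ) B) z :=
        fun z => (Matrix.toEuclideanCLM (𝕜 := ℝ) B).hasFDerivAt
      have h1 := ((hB' _).comp z ((hHd (mApp B z)).comp z (hB' z))).sub (hasFDerivAt_id z)
      rw [map_sub, map_mul, map_mul, map_one, mul_assoc]
      exact h1
    have hbound : ∀ z ∈ Metric.closedBall (mApp sqH xs) R,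
        spec (B * Hess (mApp B z) * B - 1) ≤ M / μ ^ ((3 : ℝ) / 2) * R := by
      intro z hz
      rw [mem_closedBall_iff_norm] at hz
      have hR : 0 ≤ R := (norm_nonneg _).trans hz
      have h1 : B * Hess (mApp B z) * B - 1 = B * (Hess (mApp B z) - Hess xs) * B := by
        have h2 : B * Hess xs * B = 1 := by
          rw [← hsqH2, ← mul_assoc B, hBS, one_mul, hSB]
        rw [mul_sub, sub_mul, h2]
      refine ContinuousLinearMap.opNorm_le_bound _ (by positivity) fun v => ?_
      change ‖mApp _ v‖ ≤ _
      rw [h1, mApp_mul, mApp_mul]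
      have h3 : ‖mApp B z - xs‖ ≤ (Real.sqrt μ)⁻¹ * R := by
        have h4 := hBn (z - mApp sqH xs)
        rw [mApp_sub, hBSv] at h4
        exact h4.trans (by gcongr)
      calc _ ≤ (Real.sqrt μ)⁻¹ * ‖mApp (Hess (mApp B z) - Hess xs) (mApp B v)‖ := hBn _
        _ ≤ (Real.sqrt μ)⁻¹ * (M * ((Real.sqrt μ)⁻¹ * R) * ((Real.sqrt μ)⁻¹ * ‖v‖)) := by
          gcongr
          refine (norm_mApp_le_spec _ _).trans ?_
          gcongr
          · exact (hLip _).trans (by gcongr)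
          · exact hBn v
        _ = _ := by
          rw [hpow]
          field_simp
    have h5 := (convex_closedBall (mApp sqH xs) R).norm_image_sub_le_of_norm_hasFDerivWithin_le
      (fun z _ => (hder z).hasFDerivWithinAt) hbound
      (mem_closedBall_iff_norm.2 hwR') (mem_closedBall_iff_norm.2 hwR)
    rwa [sub_sub_sub_comm] at h5
  have hHB : ∀ A v, mApp (sqH * A * sqH) (mApp B v) = mApp sqH (mApp A v) := fun A v => by
    rw [mApp_mul, mApp_mul, hSBv]
  have key := bfgs_cumulative_residual_bound_normalized G (mApp sqH xs)
    (M / μ ^ ((3 : ℝ) / 2)) hK (by rw [hGS, hgxs, mApp_zero])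
    hGdiff (fun k => mApp sqH (x k)) (fun k => sqH * H k * sqH)
    (fun k => by rw [hGS, hHB, hxup, mApp_sub])
    (fun k h => hsne k (by
      rw [← mApp_sub] at h
      rw [← hBSv (x (k + 1) - x k), h, mApp_zero]))
    (fun k => by
      rw [hGS, hGS, ← mApp_sub, ← mApp_sub, hHup]
      generalize g (x (k + 1)) - g (x k) = y
      generalize x (k + 1) - x k = s
      have h1 : dot (mApp B y) (mApp sqH s) = dot y s := by rw [dot_mApp, hSt, hSBv]
      have h2 : dot (mApp sqH s) (mApp B y) = dot s y := by rw [dot_mApp, hBt, hBSv]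
      rw [bfgsUpdate, bfgsUpdate, h1, h2]
      have h3 : outer (mApp sqH s) (mApp B y) = sqH * outer s y * B := by
        rw [mul_outer, outer_mul, hBt]
      have h4 : outer (mApp B y) (mApp sqH s) = B * outer y s * sqH := by
        rw [mul_outer, outer_mul, hSt]
      have h5 : outer (mApp sqH s) (mApp sqH s) = sqH * outer s s * sqH := by
        rw [mul_outer, outer_mul, hSt]
      have h6 : (1 - (dot y s)⁻¹ • (sqH * outer s y * B)) * sqH
          = sqH * (1 - (dot y s)⁻¹ • outer s y) := by
        rw [sub_mul, mul_sub, one_mul, mul_one, smul_mul_assoc, mul_smul_comm, mul_assoc _ B, hBS,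
          mul_one]
      have h7 : sqH * (1 - (dot s y)⁻¹ • (B * outer y s * sqH))
          = (1 - (dot s y)⁻¹ • outer y s) * sqH := by
        rw [sub_mul, mul_sub, one_mul, mul_one, smul_mul_assoc, mul_smul_comm, mul_assoc B,
          ← mul_assoc sqH B, hSB, one_mul]
      rw [h3, h4, h5, ← mul_assoc _ (sqH * H k), ← mul_assoc _ sqH, h6, mul_assoc _ sqH, h7]
      simp only [mul_add, add_mul, mul_assoc, smul_mul_assoc, mul_smul_comm])
    ε δ r hδ hr0 hr1 hc1 hc2 (by rw [← mApp_sub]; exact hσ0) hH0 k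
  simp only [hGS, ← mApp_sub] at key
  exact key
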